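/- For the double tree DT_n of depth n (n ≥ 1), Mcut(DT_n) = 2/(2^{n+1} − 3). -/

import Mathlib

open Finset

/-- The degree of vertex `i` in a weighted graph with weight matrix `W`. -/
noncomputable def wdeg {V : Type} [Fintype V] (W : Matrix V V ℝ) (i : V) : ℝ := ∑ j, W i j

/-- `vol(A) = ∑_{i ∈ A} d_i`. -/
noncomputable def wvol {V : Type} [Fintype V] (W : Matrix V V ℝ) (A : Finset V) : ℝ :=
  ∑ i ∈ A, wdeg W i

/-- `cut(A, V∖A) = ∑_{i ∈ A, j ∉ A} w_{ij}`. -/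
noncomputable def wcut {V : Type} [Fintype V] [DecidableEq V] (W : Matrix V V ℝ)
    (A : Finset V) : ℝ :=
  ∑ i ∈ A, ∑ j ∈ Aᶜ, W i j

/-- The normalized cut `Ncut(A, V∖A) = cut(A,V∖A)·(1/vol(A) + 1/vol(V∖A))`. -/
noncomputable def wncut {V : Type} [Fintype V] [DecidableEq V] (W : Matrix V V ℝ)
    (A : Finset V) : ℝ :=
  wcut W A * (1 / wvol W A + 1 / wvol W Aᶜ)

/-- The minimum normalized cut `Mcut(G)`: the minimum of `Ncut(A, V∖A)` over all
nonempty proper subsets `A` of the vertex set. -/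
noncomputable def wmcut {V : Type} [Fintype V] [DecidableEq V] (W : Matrix V V ℝ) : ℝ :=
  sInf {x : ℝ | ∃ A : Finset V, A.Nonempty ∧ Aᶜ.Nonempty ∧ x = wncut W A}

/-- The weight (adjacency) matrix of the double tree `DT_n`: two complete binary trees
of depth `n` (vertices indexed heap-style by `1, ..., 2^n − 1`, shifted to
`Fin (2^n − 1)`, the parent of node `j` (1-based) being `j/2`), one for each value of
the `Bool` component, with an extra edge joining the two roots. -/
noncomputable def doubleTreeW (n : ℕ) :
    Matrix (Bool × Fin (2 ^ n - 1)) (Bool × Fin (2 ^ n - 1)) ℝ :=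
  Matrix.of fun p q =>
    if (p.1 = q.1 ∧ (p.2.val + 1 = (q.2.val + 1) / 2 ∨ q.2.val + 1 = (p.2.val + 1) / 2))
        ∨ (p.1 ≠ q.1 ∧ p.2.val = 0 ∧ q.2.val = 0) then 1 else 0

section WeightedGraph

variable {V : Type} [Fintype V] [DecidableEq V] {W : Matrix V V ℝ}

theorem wvol_add_wvol_compl (W : Matrix V V ℝ) (A : Finset V) :
    wvol W A + wvol W Aᶜ = wvol W univ :=
  sum_add_sum_compl A _

theorem wcut_compl (hW : W.IsSymm) (A : Finset V) : wcut W Aᶜ = wcut W A := by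
  unfold wcut
  rw [compl_compl]
  exact sum_comm.trans (sum_congr rfl fun i _ => sum_congr rfl fun j _ => hW.apply i j)

theorem wcut_le_wvol (hW : ∀ i j, 0 ≤ W i j) (A : Finset V) : wcut W A ≤ wvol W A :=
  sum_le_sum fun i _ => sum_le_univ_sum_of_nonneg (hW i)

theorem le_wcut_of_mem (hW : ∀ i j, 0 ≤ W i j) {A : Finset V} {i j : V} (hi : i ∈ A)
    (hj : j ∉ A) : W i j ≤ wcut W A :=
  (single_le_sum (f := fun j => W i j) (fun j _ => hW i j) (mem_compl.2 hj)).trans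
    (single_le_sum (f := fun i => ∑ j ∈ Aᶜ, W i j) (fun i _ => sum_nonneg fun j _ => hW i j) hi)

theorem four_div_wvol_univ_le_wncut (hW : ∀ i j, 0 ≤ W i j) (hs : W.IsSymm) {A : Finset V}
    (hA : 1 ≤ wcut W A) : 4 / wvol W univ ≤ wncut W A := by
  have hx : 0 < wvol W A := by linarith [wcut_le_wvol hW A]
  have hy : 0 < wvol W Aᶜ := by linarith [wcut_le_wvol hW Aᶜ, wcut_compl hs A]
  rw [← wvol_add_wvol_compl W A, wncut]
  set x := wvol W A
  set y := wvol W Aᶜ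
  have h : 4 / (x + y) ≤ 1 / x + 1 / y := by
    rw [div_add_div _ _ hx.ne' hy.ne', div_le_div_iff₀ (by positivity) (by positivity)]
    nlinarith [sq_nonneg (x - y)]
  exact h.trans (le_mul_of_one_le_left (by positivity) hA)

end WeightedGraph

theorem doubleTreeW_nonneg (n : ℕ) (p q : Bool × Fin (2 ^ n - 1)) : 0 ≤ doubleTreeW n p q := by
  simp only [doubleTreeW, Matrix.of_apply]
  split_ifs <;> norm_num

theorem doubleTreeW_isSymm (n : ℕ) : (doubleTreeW n).IsSymm := by
  refine Matrix.IsSymm.ext fun p q => ?_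
  simp only [doubleTreeW, Matrix.of_apply]
  congr 1
  grind

/-- The double tree is connected: every proper nonempty vertex set is left by an edge. -/
theorem one_le_wcut_doubleTreeW {n : ℕ} (hn : 1 ≤ n) {A : Finset (Bool × Fin (2 ^ n - 1))}
    (hA : A.Nonempty) (hAc : Aᶜ.Nonempty) : 1 ≤ wcut (doubleTreeW n) A := by
  by_contra! hlt
  have hm : 0 < 2 ^ n - 1 := by have := Nat.pow_le_pow_right two_pos hn; omega
  have hstep : ∀ p q, doubleTreeW n p q = 1 → (p ∈ A ↔ q ∈ A) := by
    intro p q h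
    have key : ∀ p q, doubleTreeW n p q = 1 → p ∈ A → q ∈ A := by
      intro p q h hp
      by_contra hq
      linarith [le_wcut_of_mem (doubleTreeW_nonneg n) hp hq]
    exact ⟨key p q h, key q p ((doubleTreeW_isSymm n).apply p q ▸ h)⟩
  have hroots : ((true, ⟨0, hm⟩) ∈ A ↔ (false, ⟨0, hm⟩) ∈ A) :=
    hstep _ _ (by simp [doubleTreeW])
  have hroot : ∀ k (hk : k < 2 ^ n - 1) (b : Bool),
      ((b, ⟨k, hk⟩) ∈ A ↔ (false, ⟨0, hm⟩) ∈ A) := by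
    intro k
    induction k using Nat.strong_induction_on with
    | _ k ih =>
      intro hk b
      obtain rfl | hk0 := Nat.eq_zero_or_pos k
      · cases b
        · rfl
        · exact hroots
      · rw [← ih ((k + 1) / 2 - 1) (by omega) (by omega) b]
        refine hstep _ _ ?_
        exact if_pos (Or.inl ⟨rfl, Or.inr (by grind)⟩)
  obtain ⟨⟨b, k⟩, hp⟩ := hA
  obtain ⟨⟨c, l⟩, hq⟩ := hAc
  exact mem_compl.1 hq ((hroot l l.2 c).2 ((hroot k k.2 b).1 hp))

/-- In the heap on `m` nodes, every node but the root has exactly one parent. -/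
theorem sum_sum_ite_parent {m : ℕ} (hm : 0 < m) :
    ∑ j : Fin m, ∑ i : Fin m, (if i.val + 1 = (j.val + 1) / 2 then (1 : ℝ) else 0) = m - 1 := by
  have h : ∀ j : Fin m, ∑ i : Fin m, (if i.val + 1 = (j.val + 1) / 2 then (1 : ℝ) else 0) =
      1 - if j = ⟨0, hm⟩ then 1 else 0 := by
    intro j
    by_cases hj : j = ⟨0, hm⟩
    · simp [hj]
    · have hj' : j.val ≠ 0 := fun h => hj (Fin.ext h)
      rw [if_neg hj, sum_eq_single_of_mem ⟨(j.val + 1) / 2 - 1, by omega⟩ (mem_univ _)]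
      · rw [if_pos (by simp only; omega)]
        simp
      · intro i _ hi
        refine if_neg fun h => hi (Fin.ext ?_)
        simp only
        omega
  simp [h, sum_sub_distrib]

theorem sum_sum_doubleTreeW_same {n : ℕ} (hn : 1 ≤ n) (b : Bool) :
    ∑ i, ∑ j, doubleTreeW n (b, i) (b, j) = 2 ^ (n + 1) - 4 := by
  have h1 : 1 ≤ 2 ^ n := Nat.one_le_two_pow
  have hm : 0 < 2 ^ n - 1 := by have := Nat.pow_le_pow_right two_pos hn; omega
  have h : ∀ i j : Fin (2 ^ n - 1), doubleTreeW n (b, i) (b, j) =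
      (if i.val + 1 = (j.val + 1) / 2 then 1 else 0) +
        if j.val + 1 = (i.val + 1) / 2 then 1 else 0 := by
    intro i j
    simp only [doubleTreeW, Matrix.of_apply, true_and, ne_eq, not_true_eq_false, false_and,
      or_false]
    split_ifs <;> first | omega | norm_num
  simp only [h, sum_add_distrib]
  rw [sum_comm, sum_sum_ite_parent hm]
  push_cast [Nat.cast_sub h1]
  ring

theorem sum_sum_doubleTreeW_ne {n : ℕ} (hn : 1 ≤ n) {b c : Bool} (hbc : b ≠ c) :
    ∑ i, ∑ j, doubleTreeW n (b, i) (c, j) = 1 := by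
  have hm : 0 < 2 ^ n - 1 := by have := Nat.pow_le_pow_right two_pos hn; omega
  have h : ∀ i j : Fin (2 ^ n - 1), doubleTreeW n (b, i) (c, j) =
      if i = ⟨0, hm⟩ then (if j = ⟨0, hm⟩ then 1 else 0) else 0 := by
    intro i j
    simp [doubleTreeW, hbc, Fin.ext_iff, ite_and]
  simp [h, sum_ite_eq']

theorem wvol_doubleTreeW_side {n : ℕ} (hn : 1 ≤ n) (b : Bool) :
    wvol (doubleTreeW n) ({b} ×ˢ univ) = 2 ^ (n + 1) - 3 := by
  have h : wvol (doubleTreeW n) ({b} ×ˢ univ) =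
      ∑ i, ∑ j, doubleTreeW n (b, i) (b, j) + ∑ i, ∑ j, doubleTreeW n (b, i) (!b, j) := by
    cases b <;>
      simp [wvol, wdeg, Fintype.sum_prod_type, sum_add_distrib, add_comm]
  rw [h, sum_sum_doubleTreeW_same hn, sum_sum_doubleTreeW_ne hn (by simp)]
  ring

theorem compl_side {α : Type*} [Fintype α] [DecidableEq α] (b : Bool) :
    (({b} ×ˢ univ : Finset (Bool × α)))ᶜ = {!b} ×ˢ univ := by
  ext ⟨c, i⟩
  cases b <;> cases c <;> simp

theorem wcut_doubleTreeW_side {n : ℕ} (hn : 1 ≤ n) (b : Bool) :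
    wcut (doubleTreeW n) ({b} ×ˢ univ) = 1 := by
  rw [wcut, compl_side]
  simp only [sum_product, sum_singleton]
  exact sum_sum_doubleTreeW_ne hn (by simp)

/-- For the double tree `DT_n` of depth `n ≥ 1`, `Mcut(DT_n) = 2/(2^{n+1} − 3)`. -/
theorem mcut_doubleTree (n : ℕ) (hn : 1 ≤ n) :
    wmcut (doubleTreeW n) = 2 / (2 ^ (n + 1) - 3 : ℝ) := by
  have hm : 0 < 2 ^ n - 1 := by have := Nat.pow_le_pow_right two_pos hn; omega
  refine IsLeast.csInf_eq ⟨⟨{false} ×ˢ univ, ⟨(false, ⟨0, hm⟩), by simp⟩,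
    ⟨(true, ⟨0, hm⟩), by simp⟩, ?_⟩, ?_⟩
  · rw [wncut, compl_side, wcut_doubleTreeW_side hn, wvol_doubleTreeW_side hn,
      wvol_doubleTreeW_side hn]
    ring
  · rintro _ ⟨A, hA, hAc, rfl⟩
    have hvol : wvol (doubleTreeW n) univ = 2 * (2 ^ (n + 1) - 3) := by
      rw [← wvol_add_wvol_compl _ ({false} ×ˢ univ), compl_side, wvol_doubleTreeW_side hn,
        wvol_doubleTreeW_side hn]
      ring
    have h := four_div_wvol_univ_le_wncut (doubleTreeW_nonneg n) (doubleTreeW_isSymm n)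
      (one_le_wcut_doubleTreeW hn hA hAc)
    rwa [hvol, show (4 : ℝ) = 2 * 2 by norm_num, mul_div_mul_left _ _ two_ne_zero] at h
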